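/- Let Γ be a Coxeter graph with vertex set S and let X ⊆ S. If the word problem in the virtual Artin group VA[Γ] is solvable, then the strong membership problem for the standard parabolic subgroup VA_X[Γ] in VA[Γ] is solvable: there is an algorithm that, given a word ω over the generators {σ_s^{±1}, τ_s | s ∈ S}, decides whether the element of VA[Γ] represented by ω belongs to VA_X[Γ] and, if so, outputs a word over {σ_x^{±1}, τ_x | x ∈ X} representing the same element. -/

import Mathlib

noncomputable instance (priority := 50) fintypePrimcodable {α : Type*} [Fintype α] [DecidableEq α] :
    Primcodable α :=
  Primcodable.ofEquiv (Fin (Fintype.card α)) (Fintype.equivFin α)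

/-- The alternating product `a b a b ⋯` of length `m`. -/
def altProd {G : Type*} [Monoid G] (a b : G) (m : ℕ) : G :=
  ((List.range m).map (fun i => if i % 2 = 0 then a else b)).prod

/-- The defining relations of the virtual Artin group of a Coxeter matrix `M`.
The generator `Sum.inl s` plays the role of `σ_s` and `Sum.inr s` plays the role of `τ_s`.
The value `M s t = 0` encodes `m_{s,t} = ∞`. -/
def vaRels {S : Type*} (M : CoxeterMatrix S) : Set (FreeGroup (S ⊕ S)) :=
  {r | ∃ s t : S, s ≠ t ∧ M s t ≠ 0 ∧
      r = altProd (FreeGroup.of (Sum.inl s)) (FreeGroup.of (Sum.inl t)) (M s t) *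
        (altProd (FreeGroup.of (Sum.inl t)) (FreeGroup.of (Sum.inl s)) (M s t))⁻¹} ∪
  {r | ∃ s : S, r = FreeGroup.of (Sum.inr s) * FreeGroup.of (Sum.inr s)} ∪
  {r | ∃ s t : S, s ≠ t ∧ M s t ≠ 0 ∧
      r = altProd (FreeGroup.of (Sum.inr s)) (FreeGroup.of (Sum.inr t)) (M s t) *
        (altProd (FreeGroup.of (Sum.inr t)) (FreeGroup.of (Sum.inr s)) (M s t))⁻¹} ∪
  {r | ∃ s t : S, s ≠ t ∧ M s t ≠ 0 ∧
      r = FreeGroup.of (Sum.inl s) *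
          altProd (FreeGroup.of (Sum.inr t)) (FreeGroup.of (Sum.inr s)) (M s t - 1) *
        (altProd (FreeGroup.of (Sum.inr t)) (FreeGroup.of (Sum.inr s)) (M s t - 1) *
          FreeGroup.of (Sum.inl (if Even (M s t) then s else t)))⁻¹}

/-- The virtual Artin group `VA[Γ]` of a Coxeter matrix. -/
def VirtualArtinGroup {S : Type*} (M : CoxeterMatrix S) : Type _ :=
  PresentedGroup (vaRels M)

instance {S : Type*} (M : CoxeterMatrix S) : Group (VirtualArtinGroup M) := by
  unfold VirtualArtinGroup; infer_instance

/-- The generator `σ_s` of the virtual Artin group. -/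
def VirtualArtinGroup.sigma {S : Type*} (M : CoxeterMatrix S) (s : S) : VirtualArtinGroup M :=
  PresentedGroup.of (Sum.inl s)

/-- The generator `τ_s` of the virtual Artin group. -/
def VirtualArtinGroup.tau {S : Type*} (M : CoxeterMatrix S) (s : S) : VirtualArtinGroup M :=
  PresentedGroup.of (Sum.inr s)

/-- The standard parabolic subgroup `VA_X[Γ]` of the virtual Artin group, generated by
`{σ_x | x ∈ X} ∪ {τ_x | x ∈ X}`. -/
def VirtualArtinGroup.parabolic {S : Type*} (M : CoxeterMatrix S) (X : Set S) :
    Subgroup (VirtualArtinGroup M) :=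
  Subgroup.closure ((fun s => VirtualArtinGroup.sigma M s) '' X ∪
    (fun s => VirtualArtinGroup.tau M s) '' X)

/-- Evaluation in `G` of a word over an alphabet `A` of generators together with formal
inverses: the letter `(a, true)` is the generator `gen a` and `(a, false)` is its inverse. -/
def evalWord {A G : Type*} [Group G] (gen : A → G) (w : List (A × Bool)) : G :=
  (w.map fun p => if p.2 then gen p.1 else (gen p.1)⁻¹).prod

/-- A group `G` has a solvable word problem with respect to a generating family `gen : A → G`
if there is an algorithm deciding whether a word over `A ⊔ A⁻¹` represents the identity. -/
def SolvableWordProblem {A G : Type*} [Primcodable A] [Group G] (gen : A → G) : Prop :=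
  ComputablePred fun w : List (A × Bool) => evalWord gen w = 1

/-- The strong membership problem for the subgroup `H` of `G` is solvable (with respect to a
generating family `gen : A → G` of `G`, the subgroup `H` being generated by the generators
indexed by `Asub ⊆ A`): there is an algorithm that decides whether the element represented by a
word `w` over `A ⊔ A⁻¹` belongs to `H` and, if so, outputs a word all of whose letters come from
`Asub ⊔ Asub⁻¹` representing the same element. -/
def SolvableStrongMembership {A G : Type*} [Primcodable A] [Group G] (gen : A → G)
    (Asub : Set A) (H : Subgroup G) : Prop :=
  ∃ f : List (A × Bool) → Option (List (A × Bool)), Computable f ∧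
    ∀ w : List (A × Bool),
      (evalWord gen w ∈ H ↔ (f w).isSome) ∧
      ∀ μ, f w = some μ → (∀ p ∈ μ, p.1 ∈ Asub) ∧ evalWord gen μ = evalWord gen w

namespace CoxeterSystem

section Geometric

open Polynomial.Chebyshev Real

variable {B : Type*} (M : CoxeterMatrix B)

/-- The linear form `v ↦ 2 ⟨α_i, v⟩` on the geometric representation of a Coxeter group. -/
noncomputable def geomForm (i : B) : Module.Dual ℝ (B →₀ ℝ) :=
  Finsupp.linearCombination ℝ fun j => -2 * cos (π / M i j)

theorem geomForm_single (i j : B) :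
    geomForm M i (Finsupp.single j 1) = -2 * cos (π / M i j) := by
  simp [geomForm]

theorem geomForm_self (i : B) : geomForm M i (Finsupp.single i 1) = 2 := by
  simp [geomForm_single]

/-- The simple reflections of the geometric representation of a Coxeter group. -/
noncomputable def geomReflection (i : B) : (B →₀ ℝ) ≃ₗ[ℝ] (B →₀ ℝ) :=
  Module.reflection (geomForm_self M i)

theorem geomForm_mul_geomForm (i j : B) :
    2 * cos (2 * (π / M i j)) =
      geomForm M i (Finsupp.single j 1) * geomForm M j (Finsupp.single i 1) - 2 := by
  rw [geomForm_single, geomForm_single, M.symmetric j i, cos_two_mul]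
  ring

theorem sin_two_pi_div_pos {m : ℕ} (hm : 3 ≤ m) : 0 < sin (2 * (π / m)) := by
  have h3 : (3 : ℝ) ≤ m := by exact_mod_cast hm
  have hp := pi_pos
  apply sin_pos_of_pos_of_lt_pi
  · positivity
  · rw [← mul_div_assoc, div_lt_iff₀ (by linarith)]
    nlinarith

theorem geomReflection_isLiftable : M.IsLiftable (geomReflection M) := by
  intro i j
  apply LinearEquiv.ext
  intro z
  rcases Nat.lt_or_ge (M i j) 3 with hlt | hge
  · have hcases : M i j = 0 ∨ M i j = 1 ∨ M i j = 2 := by omega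
    rcases hcases with h | h | h
    · simp [h]
    · have hij : i = j := by
        by_contra hne
        exact M.off_diagonal i j hne h
      subst hij
      rw [h, pow_one]
      exact Module.involutive_reflection (geomForm_self M i) z
    · have hcos : cos (2 * (π / (2 : ℕ))) = -1 := by
        rw [show 2 * (π / ((2 : ℕ) : ℝ)) = π by push_cast; ring, cos_pi]
      rw [geomReflection, geomReflection, Module.reflection_mul_reflection_pow_apply _ _ _ _ _
        (geomForm_mul_geomForm M i j), geomForm_single, geomForm_single, M.symmetric j i, h, hcos]
      norm_num
      abel
  · obtain hpos := sin_two_pi_div_pos hge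
    have hm0 : (M i j : ℝ) ≠ 0 := by positivity
    rw [geomReflection, geomReflection, Module.reflection_mul_reflection_pow_apply _ _ _ _ _
      (geomForm_mul_geomForm M i j)]
    have hS := fun n : ℤ => S_two_mul_real_cos (2 * (π / M i j)) n
    rcases Nat.even_or_odd' (M i j) with ⟨k, hk | hk⟩
    · have h1 : (S ℝ ((k : ℤ) - 1)).eval (2 * cos (2 * (π / M i j))) = 0 := by
        have := hS ((k : ℤ) - 1)
        have h2 : ((((k : ℤ) - 1 : ℤ) : ℝ) + 1) * (2 * (π / M i j)) = π := by
          have : (M i j : ℝ) = 2 * k := by exact_mod_cast hk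
          push_cast
          field_simp
          linarith
        rw [h2, sin_pi] at this
        exact (mul_eq_zero.1 this).resolve_right hpos.ne'
      have e1 : ((M i j : ℤ) - 2) / 2 = k - 1 := by omega
      have e2 : ((M i j : ℤ) - 1) / 2 = k - 1 := by omega
      rw [e1, e2, h1]
      simp
    · have h1 : (S ℝ (k : ℤ)).eval (2 * cos (2 * (π / M i j))) +
          (S ℝ ((k : ℤ) - 1)).eval (2 * cos (2 * (π / M i j))) = 0 := by
        have h3 := hS k
        have h4 := hS ((k : ℤ) - 1)
        have h2 : ((((k : ℤ) - 1 : ℤ) : ℝ) + 1) * (2 * (π / M i j)) = π - π / M i j := by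
          have : (M i j : ℝ) = 2 * k + 1 := by exact_mod_cast hk
          push_cast
          field_simp
          linarith
        have h2' : (((k : ℤ) : ℝ) + 1) * (2 * (π / M i j)) = π / M i j + π := by
          have : (M i j : ℝ) = 2 * k + 1 := by exact_mod_cast hk
          push_cast
          field_simp
          linarith
        rw [h2, sin_pi_sub] at h4
        rw [h2', sin_add_pi] at h3
        have : ((S ℝ (k : ℤ)).eval (2 * cos (2 * (π / M i j))) +
          (S ℝ ((k : ℤ) - 1)).eval (2 * cos (2 * (π / M i j)))) * sin (2 * (π / M i j)) = 0 := by
          linarith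
        exact (mul_eq_zero.1 this).resolve_right hpos.ne'
      have e1 : ((M i j : ℤ) - 2) / 2 = k - 1 := by omega
      have e2 : ((M i j : ℤ) - 1) / 2 = k := by omega
      have e3 : ((M i j : ℤ) - 3) / 2 = k - 1 := by omega
      have e4 : (M i j : ℤ) / 2 = k := by omega
      rw [e1, e2, e3, e4, h1]
      simp

theorem geomReflection_pow_ne_one {i j : B} (hij : i ≠ j) {k : ℕ} (hk : 0 < k)
    (hkm : M i j = 0 ∨ k < M i j) : (geomReflection M i * geomReflection M j) ^ k ≠ 1 := by
  intro h
  have h1 := congrArg (fun φ => φ (Finsupp.single i 1)) h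
  simp only [geomReflection, LinearEquiv.coe_one, id_eq] at h1
  rw [Module.reflection_mul_reflection_pow_apply_self _ _ _ _
      (geomForm_mul_geomForm M i j)] at h1
  have hi := DFunLike.congr_fun h1 i
  have hj := DFunLike.congr_fun h1 j
  simp [hij, hij.symm, geomForm_single, M.symmetric j i] at hi hj
  have h0 := M.off_diagonal i j hij
  rcases Nat.lt_or_ge (M i j) 3 with hlt | hge
  · have hcases : M i j = 0 ∨ M i j = 2 := by omega
    rcases hcases with hm | hm
    · rw [hm] at hj
      simp at hj
      omega
    · have : k = 1 := by omega
      subst this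
      rw [hm, show 2 * (π / ((2 : ℕ) : ℝ)) = π by push_cast; ring, cos_pi] at hi
      norm_num at hi
  · have hpos := sin_two_pi_div_pos hge
    have hS := fun n : ℤ => S_two_mul_real_cos (2 * (π / M i j)) n
    have hcos : 0 < cos (π / M i j) := by
      apply cos_pos_of_mem_Ioo
      have h3 : (3 : ℝ) ≤ M i j := by exact_mod_cast hge
      have hp := pi_pos
      constructor
      · have : 0 < π / M i j := by positivity
        linarith
      · rw [div_lt_div_iff₀ (by linarith) (by norm_num)]
        nlinarith
    have hz : (S ℝ ((k : ℤ) - 1)).eval (2 * cos (2 * (π / M i j))) = 0 := by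
      rcases hj with hj | hj
      · exact hj
      · exact absurd hj hcos.ne'
    have hone : (S ℝ (k : ℤ)).eval (2 * cos (2 * (π / M i j))) = 1 := by
      rw [hz] at hi; simpa using hi
    have a1 := hS ((k : ℤ) - 1)
    have a2 := hS k
    rw [hz] at a1
    rw [hone] at a2
    push_cast at a1 a2
    rw [sub_add_cancel, zero_mul] at a1
    rw [add_mul, one_mul, one_mul, sin_add, ← a1, zero_mul, zero_add] at a2
    have hc : cos (k * (2 * (π / M i j))) = 1 := by
      have : (cos (k * (2 * (π / M i j))) - 1) * sin (2 * (π / M i j)) = 0 := by linarith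
      linarith [(mul_eq_zero.1 this).resolve_right hpos.ne']
    have hkm' : k < M i j := by omega
    have hk' : (k : ℝ) < M i j := by exact_mod_cast hkm'
    have hm0 : (0 : ℝ) < M i j := by positivity
    have hkp : (0 : ℝ) < k := by exact_mod_cast hk
    obtain ⟨n, hn⟩ := (cos_eq_one_iff _).1 hc
    have hp := pi_pos
    have hn' : (n : ℝ) * M i j = k := by
      have h2 : (n : ℝ) * M i j * (2 * π) = k * (2 * π) := by
        calc (n : ℝ) * M i j * (2 * π) = n * (2 * π) * M i j := by ring
          _ = k * (2 * (π / M i j)) * M i j := by rw [hn]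
          _ = _ := by field_simp
      exact mul_right_cancel₀ (by positivity) h2
    have hn'' : n * (M i j : ℤ) = k := by exact_mod_cast hn'
    rcases lt_trichotomy n 0 with hneg | hzero | hposn
    · nlinarith
    · subst hzero
      omega
    · nlinarith

end Geometric

variable {B W : Type*} [Group W] {M : CoxeterMatrix B} (cs : CoxeterSystem M W)

theorem simple_mul_simple_pow_ne_one {i j : B} (hij : i ≠ j) {k : ℕ} (hk : 0 < k)
    (hkm : M i j = 0 ∨ k < M i j) : (cs.simple i * cs.simple j) ^ k ≠ 1 := by
  intro h
  apply geomReflection_pow_ne_one M hij hk hkm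
  have := congrArg (cs.lift ⟨_, geomReflection_isLiftable M⟩) h
  simpa [cs.lift_apply_simple] using this

theorem orderOf_simple_mul_simple (i j : B) :
    orderOf (cs.simple i * cs.simple j) = M i j := by
  by_cases hij : i = j
  · subst hij
    simp
  · rcases Nat.eq_zero_or_pos (M i j) with h0 | hpos
    · rw [h0, orderOf_eq_zero_iff']
      exact fun k hk => cs.simple_mul_simple_pow_ne_one hij hk (Or.inl h0)
    · exact (orderOf_eq_iff hpos).2 ⟨cs.simple_mul_simple_pow i j,
        fun k hk hk0 => cs.simple_mul_simple_pow_ne_one hij hk0 (Or.inr hk)⟩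

theorem simple_injective : Function.Injective cs.simple := by
  intro i j h
  by_contra hij
  have h1 := cs.orderOf_simple_mul_simple i j
  rw [h, cs.simple_mul_simple_self, orderOf_one] at h1
  exact M.off_diagonal i j hij h1.symm

end CoxeterSystem

namespace CoxeterSystem

variable {B W : Type*} [Group W] {M : CoxeterMatrix B} (cs : CoxeterSystem M W)

section InversionParity

open scoped Classical in
/-- The permutation of `W × ℤ/2` by which a simple reflection acts: it conjugates the first
coordinate, and flips the second one when the first one is the simple reflection itself. -/
noncomputable def inversionPerm (i : B) : Equiv.Perm (W × ZMod 2) :=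
  Function.Involutive.toPerm
    (fun p => (cs.simple i * p.1 * cs.simple i, p.2 + if p.1 = cs.simple i then 1 else 0)) <| by
    rintro ⟨r, e⟩
    have h : cs.simple i * r * cs.simple i = cs.simple i ↔ r = cs.simple i := by
      constructor
      · intro h
        have h' : cs.simple i * (cs.simple i * r * cs.simple i) * cs.simple i =
          cs.simple i * cs.simple i * cs.simple i := by rw [h]
        simpa [mul_assoc] using h'
      · rintro rfl
        simp
    have h2 : (if r = cs.simple i then (1 : ZMod 2) else 0) +
        (if r = cs.simple i then 1 else 0) = 0 := CharTwo.add_self_eq_zero _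
    refine Prod.ext (by simp [mul_assoc]) ?_
    simp only [h, add_assoc, h2, add_zero]

open scoped Classical in
theorem inversionPerm_apply (i : B) (p : W × ZMod 2) :
    cs.inversionPerm i p =
      (cs.simple i * p.1 * cs.simple i, p.2 + if p.1 = cs.simple i then 1 else 0) := rfl

theorem simple_mul_pow (i j : B) (k : ℕ) :
    cs.simple j * (cs.simple i * cs.simple j) ^ k =
      ((cs.simple i * cs.simple j) ^ k)⁻¹ * cs.simple j := by
  induction k with
  | zero => simp
  | succ k ih =>
    rw [pow_succ, ← mul_assoc, ih, ← pow_succ, pow_succ', mul_inv_rev, mul_inv_rev, inv_simple,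
      inv_simple]
    simp [mul_assoc]

open scoped Classical in
theorem inversionPerm_mul_pow_apply (i j : B) (k : ℕ) (r : W) (e : ZMod 2) :
    ((cs.inversionPerm i * cs.inversionPerm j) ^ k) (r, e) =
      ((cs.simple i * cs.simple j) ^ k * r * ((cs.simple i * cs.simple j) ^ k)⁻¹,
        e + ∑ l ∈ Finset.range (2 * k),
          if r = cs.simple j * (cs.simple i * cs.simple j) ^ l then 1 else 0) := by
  induction k with
  | zero => simp
  | succ k ih =>
    have h1 : (cs.simple i * cs.simple j) ^ k * r * ((cs.simple i * cs.simple j) ^ k)⁻¹ =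
        cs.simple j ↔ r = cs.simple j * (cs.simple i * cs.simple j) ^ (2 * k) := by
      rw [two_mul, pow_add, ← mul_assoc, simple_mul_pow, mul_inv_eq_iff_eq_mul,
        mul_assoc _ _ (_ ^ k), eq_inv_mul_iff_mul_eq]
    have h2 : cs.simple j * ((cs.simple i * cs.simple j) ^ k * r *
        ((cs.simple i * cs.simple j) ^ k)⁻¹) * cs.simple j = cs.simple i ↔
        r = cs.simple j * (cs.simple i * cs.simple j) ^ (2 * k + 1) := by
      rw [show 2 * k + 1 = k + (1 + k) by ring, pow_add, pow_add, pow_one,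
        ← mul_assoc (cs.simple j) (_ ^ k), simple_mul_pow, mul_assoc _ (cs.simple j),
        eq_inv_mul_iff_mul_eq]
      generalize (cs.simple i * cs.simple j) ^ k = q
      constructor
      · intro h
        calc q * r
          _ = cs.simple j * (cs.simple j * (q * r * q⁻¹) * cs.simple j) * cs.simple j * q := by
              simp [mul_assoc]
          _ = _ := by rw [h]; simp [mul_assoc]
      · intro h
        rw [h]
        simp [mul_assoc]
    rw [pow_succ', Equiv.Perm.mul_apply, ih, Equiv.Perm.mul_apply, inversionPerm_apply,
      inversionPerm_apply, show 2 * (k + 1) = 2 * k + 1 + 1 by ring, Finset.sum_range_succ,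
      Finset.sum_range_succ]
    simp only [h1, h2]
    rw [Prod.mk.injEq]
    constructor
    · rw [pow_succ']
      simp [mul_assoc]
    · ring

theorem inversionPerm_isLiftable : M.IsLiftable cs.inversionPerm := by
  classical
  intro i j
  ext1 ⟨r, e⟩
  rw [inversionPerm_mul_pow_apply, cs.simple_mul_simple_pow, two_mul, Finset.sum_range_add]
  simp only [pow_add, cs.simple_mul_simple_pow, one_mul, CharTwo.add_self_eq_zero]
  simp

/-- The parity of the number of times a given element occurs in the right inversion sequence of
any word representing `w`. -/
noncomputable def inversionParity (w r : W) : ZMod 2 :=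
  (cs.lift ⟨_, cs.inversionPerm_isLiftable⟩ w (r, 0)).2

theorem lift_inversionPerm_apply (w r : W) (e : ZMod 2) :
    cs.lift ⟨_, cs.inversionPerm_isLiftable⟩ w (r, e) =
      (w * r * w⁻¹, e + cs.inversionParity w r) := by
  have key : (∀ r e, (cs.lift ⟨_, cs.inversionPerm_isLiftable⟩ w (r, e)).1 = w * r * w⁻¹) ∧
      ∀ r e, (cs.lift ⟨_, cs.inversionPerm_isLiftable⟩ w (r, e)).2 =
        e + (cs.lift ⟨_, cs.inversionPerm_isLiftable⟩ w (r, 0)).2 := by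
    induction w using cs.simple_induction_left with
    | one => simp
    | mul_simple_left w i ih =>
      obtain ⟨h1, h2⟩ := ih
      simp only [map_mul, Equiv.Perm.mul_apply, cs.lift_apply_simple]
      constructor
      · intro r e
        rw [inversionPerm_apply, h1]
        simp [mul_assoc]
      · intro r e
        rw [inversionPerm_apply, inversionPerm_apply, h1, h1, h2]
        ring
  exact Prod.ext (key.1 r e) (key.2 r e)

@[simp]
theorem inversionParity_one (r : W) : cs.inversionParity 1 r = 0 := by
  simp [inversionParity]

open scoped Classical in
theorem inversionParity_simple (i : B) (r : W) :
    cs.inversionParity (cs.simple i) r = if r = cs.simple i then 1 else 0 := by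
  simp [inversionParity, cs.lift_apply_simple, inversionPerm_apply]

theorem inversionParity_mul (u v r : W) :
    cs.inversionParity (u * v) r =
      cs.inversionParity v r + cs.inversionParity u (v * r * v⁻¹) := by
  conv_lhs => rw [inversionParity]
  rw [map_mul, Equiv.Perm.mul_apply, lift_inversionPerm_apply, lift_inversionPerm_apply]
  simp

theorem length_mul_lt_of_inversionParity_ne_zero {w r : W} (h : cs.inversionParity w r ≠ 0) :
    cs.length (w * r) < cs.length w := by
  classical
  induction hn : cs.length w generalizing w with
  | zero =>
    rw [cs.length_eq_zero_iff.1 hn] at h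
    simp at h
  | succ n ih =>
    obtain ⟨i, hi⟩ := cs.exists_leftDescent_of_ne_one (w := w) (by rintro rfl; simp at hn)
    have hi' := cs.isLeftDescent_iff.1 hi
    obtain ⟨v, rfl⟩ : ∃ v, w = cs.simple i * v := ⟨cs.simple i * w, by simp⟩
    rw [cs.simple_mul_simple_cancel_left] at hi'
    have hv : cs.length v = n := by omega
    rw [inversionParity_mul, inversionParity_simple] at h
    by_cases hr : v * r * v⁻¹ = cs.simple i
    · have : cs.simple i * v * r = v := by
        rw [← hr]
        have h2 : v * r * v⁻¹ * (v * r * v⁻¹) = 1 := by rw [hr]; simp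
        simpa [mul_assoc] using congrArg (· * v) h2
      rw [this]
      omega
    · rw [if_neg hr, add_zero] at h
      have h1 := ih h hv
      have h2 := cs.length_mul_le (cs.simple i) (v * r)
      rw [cs.length_simple] at h2
      rw [mul_assoc]
      omega

open scoped Classical in
theorem inversionParity_pow (i j : B) (k : ℕ) (r : W) :
    cs.inversionParity ((cs.simple i * cs.simple j) ^ k) r =
      ∑ l ∈ Finset.range (2 * k),
        if r = cs.simple j * (cs.simple i * cs.simple j) ^ l then 1 else 0 := by
  rw [inversionParity, map_pow, map_mul, cs.lift_apply_simple, cs.lift_apply_simple,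
    inversionPerm_mul_pow_apply]
  simp

open scoped Classical in
theorem inversionParity_simple_mul_pow (i j : B) (k : ℕ) (r : W) :
    cs.inversionParity (cs.simple j * (cs.simple i * cs.simple j) ^ k) r =
      ∑ l ∈ Finset.range (2 * k + 1),
        if r = cs.simple j * (cs.simple i * cs.simple j) ^ l then 1 else 0 := by
  have h1 : (cs.simple i * cs.simple j) ^ k * r * ((cs.simple i * cs.simple j) ^ k)⁻¹ =
      cs.simple j ↔ r = cs.simple j * (cs.simple i * cs.simple j) ^ (2 * k) := by
    rw [two_mul, pow_add, ← mul_assoc, simple_mul_pow, mul_inv_eq_iff_eq_mul, mul_assoc _ _ (_ ^ k),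
      eq_inv_mul_iff_mul_eq]
  rw [inversionParity_mul, inversionParity_pow, inversionParity_simple, Finset.sum_range_succ]
  simp only [h1]

end InversionParity

section Dihedral

variable (i j : B)

/-- The subgroup generated by two simple reflections. -/
def dihedral : Subgroup W := Subgroup.closure {cs.simple i, cs.simple j}

theorem simple_left_mem_dihedral : cs.simple i ∈ cs.dihedral i j :=
  Subgroup.subset_closure (by simp)

theorem simple_right_mem_dihedral : cs.simple j ∈ cs.dihedral i j :=
  Subgroup.subset_closure (by simp)

theorem simple_mul_zpow (k : ℤ) :
    cs.simple j * (cs.simple i * cs.simple j) ^ k =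
      (cs.simple i * cs.simple j) ^ (-k) * cs.simple j := by
  have h : cs.simple j * (cs.simple i * cs.simple j) * (cs.simple j)⁻¹ =
      (cs.simple i * cs.simple j)⁻¹ := by simp [mul_assoc]
  rw [zpow_neg, ← inv_zpow, ← h, conj_zpow]
  simp

theorem exists_zpow_of_mem_dihedral {w : W} (hw : w ∈ cs.dihedral i j) :
    ∃ k : ℤ, w = (cs.simple i * cs.simple j) ^ k ∨
      w = cs.simple j * (cs.simple i * cs.simple j) ^ k := by
  induction hw using Subgroup.closure_induction with
  | mem x hx =>
    rcases hx with rfl | rfl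
    · exact ⟨-1, Or.inr (by simp)⟩
    · exact ⟨0, Or.inr (by simp)⟩
  | one => exact ⟨0, Or.inl (by simp)⟩
  | mul x y _ _ hx hy =>
    obtain ⟨k, rfl | rfl⟩ := hx <;> obtain ⟨l, rfl | rfl⟩ := hy
    · exact ⟨k + l, Or.inl (zpow_add _ _ _).symm⟩
    · refine ⟨-k + l, Or.inr ?_⟩
      rw [zpow_add, ← mul_assoc, ← mul_assoc, simple_mul_zpow, neg_neg]
    · exact ⟨k + l, Or.inr (by rw [zpow_add, mul_assoc])⟩
    · refine ⟨-k + l, Or.inl ?_⟩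
      rw [simple_mul_zpow, zpow_add]
      simp [mul_assoc]
  | inv x _ hx =>
    obtain ⟨k, rfl | rfl⟩ := hx
    · exact ⟨-k, Or.inl (zpow_neg _ _).symm⟩
    · refine ⟨k, Or.inr ?_⟩
      rw [mul_inv_rev, inv_simple, ← zpow_neg, simple_mul_zpow]

variable {i j}

theorem exists_pow_of_mem_dihedral (hm : M i j ≠ 0) {w : W} (hw : w ∈ cs.dihedral i j) :
    ∃ k < M i j, w = (cs.simple i * cs.simple j) ^ k ∨
      w = cs.simple j * (cs.simple i * cs.simple j) ^ k := by
  obtain ⟨k, hk⟩ := cs.exists_zpow_of_mem_dihedral i j hw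
  have h0 : (M i j : ℤ) ≠ 0 := by exact_mod_cast hm
  obtain ⟨n, hn⟩ := Int.eq_ofNat_of_zero_le (Int.emod_nonneg k h0)
  have hlt := Int.emod_lt_of_pos k (b := M i j) (by omega)
  have he : (cs.simple i * cs.simple j) ^ k = (cs.simple i * cs.simple j) ^ n := by
    rw [← zpow_natCast, ← zpow_mod_orderOf, orderOf_simple_mul_simple, hn]
  rw [he] at hk
  exact ⟨n, by omega, hk⟩

theorem pow_inj_of_lt {k l : ℕ} (hk : k < M i j) (hl : l < M i j)
    (h : (cs.simple i * cs.simple j) ^ k = (cs.simple i * cs.simple j) ^ l) : k = l := by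
  rw [← cs.orderOf_simple_mul_simple i j] at hk hl
  exact pow_injOn_Iio_orderOf hk hl h

open scoped Classical in
theorem sum_inversions_ne_zero {n : ℕ} (hn : 0 < n) (hn' : n < 2 * M i j) :
    (∑ l ∈ Finset.range n,
      if cs.simple j = cs.simple j * (cs.simple i * cs.simple j) ^ l then (1 : ZMod 2) else 0) ≠ 0 ∨
    (∑ l ∈ Finset.range n,
      if cs.simple i = cs.simple j * (cs.simple i * cs.simple j) ^ l then (1 : ZMod 2) else 0)
        ≠ 0 := by
  have ho := cs.orderOf_simple_mul_simple i j
  rcases Nat.lt_or_ge (M i j) n with hlt | hge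
  · right
    have hi : ∀ l, cs.simple i = cs.simple j * (cs.simple i * cs.simple j) ^ l ↔
        M i j ∣ l + 1 := by
      intro l
      rw [← ho, orderOf_dvd_iff_pow_eq_one, pow_succ', mul_assoc, mul_eq_one_iff_inv_eq,
        inv_simple]
    rw [Finset.sum_eq_single (M i j - 1)]
    · rw [if_pos ((hi _).2 (by rw [Nat.sub_add_cancel (by omega)]))]
      exact one_ne_zero
    · intro l hl hne
      rw [Finset.mem_range] at hl
      rw [if_neg]
      rw [hi]
      rintro ⟨c, hc⟩
      have h1 : c < 2 := by
        by_contra h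
        have : M i j * 2 ≤ M i j * c := Nat.mul_le_mul_left _ (by omega)
        omega
      interval_cases c <;> omega
    · intro h
      rw [Finset.mem_range] at h
      omega
  · left
    have hj : ∀ l, cs.simple j = cs.simple j * (cs.simple i * cs.simple j) ^ l ↔ M i j ∣ l := by
      intro l
      rw [← ho, orderOf_dvd_iff_pow_eq_one, left_eq_mul]
    rw [Finset.sum_eq_single 0]
    · simp
    · intro l hl hne
      rw [Finset.mem_range] at hl
      rw [if_neg]
      rw [hj]
      intro hd
      have := Nat.le_of_dvd (by omega) hd
      omega
    · intro h
      simp at h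
      omega

theorem eq_one_of_mem_dihedral (hm : M i j ≠ 0) {w : W} (hw : w ∈ cs.dihedral i j)
    (hi : cs.inversionParity w (cs.simple i) = 0) (hj : cs.inversionParity w (cs.simple j) = 0) :
    w = 1 := by
  classical
  obtain ⟨k, hk, rfl | rfl⟩ := cs.exists_pow_of_mem_dihedral hm hw
  · rcases Nat.eq_zero_or_pos k with rfl | hpos
    · simp
    · rw [inversionParity_pow] at hi hj
      rcases cs.sum_inversions_ne_zero (i := i) (j := j) (n := 2 * k)
        (by omega) (by omega) with h | h
      · exact absurd hj h
      · exact absurd hi h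
  · rw [inversionParity_simple_mul_pow] at hi hj
    rcases cs.sum_inversions_ne_zero (i := i) (j := j) (n := 2 * k + 1)
      (by omega) (by omega) with h | h
    · exact absurd hj h
    · exact absurd hi h

end Dihedral

section Minimal

variable (X : Set B)

/-- `w` is minimal in its coset `w W_X`: no simple reflection from `X` is an inversion of `w`. -/
def IsCosetMinimal (w : W) : Prop := ∀ x ∈ X, cs.inversionParity w (cs.simple x) = 0

variable {X}

theorem isCosetMinimal_one : cs.IsCosetMinimal X 1 := fun x _ => by simp

theorem IsCosetMinimal.simple_mul {w : W} (hw : cs.IsCosetMinimal X w) {i : B}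
    (hi : ¬ ∃ x ∈ X, cs.simple i * w = w * cs.simple x) :
    cs.IsCosetMinimal X (cs.simple i * w) := by
  classical
  intro x hx
  rw [inversionParity_mul, hw x hx, inversionParity_simple, if_neg, add_zero]
  intro h
  exact hi ⟨x, hx, by rw [← h]; group⟩

theorem IsCosetMinimal.simple_mul_eq {w : W} (hw : cs.IsCosetMinimal X w) {i j : B}
    (hm : M i j ≠ 0) {x y : B} (hx : x ∈ X) (hy : y ∈ X) (hxy : x ≠ y)
    (hxD : w * cs.simple x * w⁻¹ ∈ cs.dihedral i j)
    (hyD : w * cs.simple y * w⁻¹ ∈ cs.dihedral i j) :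
    (cs.simple i * w = w * cs.simple x ∧ cs.simple j * w = w * cs.simple y) ∨
    (cs.simple i * w = w * cs.simple y ∧ cs.simple j * w = w * cs.simple x) := by
  classical
  -- the shortest element `d * w` of the coset `D w` of the dihedral subgroup `D`
  obtain ⟨d, hd, hmin⟩ : ∃ d ∈ cs.dihedral i j, ∀ e ∈ cs.dihedral i j,
      cs.length (d * w) ≤ cs.length (e * w) := by
    have hne : (cs.dihedral i j : Set W).Nonempty := ⟨1, one_mem _⟩
    obtain ⟨d, hd, h⟩ := (measure fun e => cs.length (e * w)).wf.has_min _ hne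
    exact ⟨d, hd, fun e he => not_lt.1 (h e he)⟩
  set u := d * w with hu
  have huw : w = d⁻¹ * u := by simp [hu]
  have hzero : ∀ q ∈ cs.dihedral i j, cs.inversionParity u (u⁻¹ * q * u) = 0 := by
    intro q hq
    by_contra h
    have h1 := cs.length_mul_lt_of_inversionParity_ne_zero h
    have h2 := hmin (q * d) (mul_mem hq hd)
    rw [show u * (u⁻¹ * q * u) = q * d * w by rw [hu]; group] at h1
    omega
  have hconj : ∀ z, w * cs.simple z * w⁻¹ ∈ cs.dihedral i j →
      u * cs.simple z * u⁻¹ ∈ cs.dihedral i j := by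
    intro z hz
    have := mul_mem (mul_mem hd hz) (inv_mem hd)
    rwa [show d * (w * cs.simple z * w⁻¹) * d⁻¹ = u * cs.simple z * u⁻¹ by rw [hu]; group] at this
  have hsimple : ∀ z, u * cs.simple z * u⁻¹ ∈ cs.dihedral i j →
      u * cs.simple z * u⁻¹ = cs.simple i ∨ u * cs.simple z * u⁻¹ = cs.simple j := by
    intro z hz
    by_contra hcon
    push Not at hcon
    have hpar : ∀ k, cs.simple k ∈ cs.dihedral i j → u * cs.simple z * u⁻¹ ≠ cs.simple k →
        cs.inversionParity (u * cs.simple z * u⁻¹) (cs.simple k) = 0 := by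
      intro k hk hne
      have e1 := cs.inversionParity_mul (u * cs.simple z * u⁻¹) u (u⁻¹ * cs.simple k * u)
      have e2 := cs.inversionParity_mul u (cs.simple z) (u⁻¹ * cs.simple k * u)
      rw [show u * (u⁻¹ * cs.simple k * u) * u⁻¹ = cs.simple k by group,
        show u * cs.simple z * u⁻¹ * u = u * cs.simple z by group, hzero _ hk, zero_add] at e1
      rw [← e1, e2, inversionParity_simple, if_neg, zero_add]
      · have := hzero (u * cs.simple z * u⁻¹ * cs.simple k * (u * cs.simple z * u⁻¹)⁻¹)
          (mul_mem (mul_mem hz hk) (inv_mem hz))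
        rw [← this]
        congr 1
        group
      · intro h
        apply hne
        rw [← h]
        group
    have h1 := cs.eq_one_of_mem_dihedral hm hz
      (hpar i (cs.simple_left_mem_dihedral i j) hcon.1)
      (hpar j (cs.simple_right_mem_dihedral i j) hcon.2)
    have h2 : cs.simple z = 1 := by
      rw [mul_inv_eq_one] at h1
      simpa using h1
    have h3 := cs.length_simple z
    rw [h2, cs.length_one] at h3
    omega
  have hd0 : ∀ z ∈ X, u * cs.simple z * u⁻¹ ∈ cs.dihedral i j →
      cs.inversionParity d⁻¹ (u * cs.simple z * u⁻¹) = 0 := by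
    intro z hz hzD
    have h1 := hw z hz
    rw [huw, inversionParity_mul] at h1
    have h2 := hzero _ hzD
    rw [show u⁻¹ * (u * cs.simple z * u⁻¹) * u = cs.simple z by group] at h2
    rwa [h2, zero_add] at h1
  have hne : u * cs.simple x * u⁻¹ ≠ u * cs.simple y * u⁻¹ := by
    intro h
    exact hxy (cs.simple_injective (by simpa using h))
  have hx' := hd0 x hx (hconj x hxD)
  have hy' := hd0 y hy (hconj y hyD)
  have conclude : d⁻¹ = 1 → ∀ k z, u * cs.simple z * u⁻¹ = cs.simple k →
      cs.simple k * w = w * cs.simple z := by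
    intro h1 k z h
    rw [← h, show w = u by rw [huw, h1, one_mul]]
    group
  rcases hsimple x (hconj x hxD) with h1 | h1 <;> rcases hsimple y (hconj y hyD) with h2 | h2
  · exact absurd (h1.trans h2.symm) hne
  · rw [h1] at hx'
    rw [h2] at hy'
    have hdone := cs.eq_one_of_mem_dihedral hm (inv_mem hd) hx' hy'
    exact Or.inl ⟨conclude hdone _ _ h1, conclude hdone _ _ h2⟩
  · rw [h1] at hx'
    rw [h2] at hy'
    have hdone := cs.eq_one_of_mem_dihedral hm (inv_mem hd) hy' hx'
    exact Or.inr ⟨conclude hdone _ _ h2, conclude hdone _ _ h1⟩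
  · exact absurd (h1.trans h2.symm) hne

end Minimal

end CoxeterSystem

/-- Successive application of `f 0, f 1, …, f (n - 1)`. -/
def iterSeq {α : Type*} (f : ℕ → Equiv.Perm α) (p : α) : ℕ → α
  | 0 => p
  | n + 1 => f n (iterSeq f p n)

theorem iterSeq_congr {α : Type*} {f g : ℕ → Equiv.Perm α} (p : α) {n : ℕ}
    (h : ∀ k < n, f k = g k) : iterSeq f p n = iterSeq g p n := by
  induction n with
  | zero => rfl
  | succ n ih =>
    rw [iterSeq, iterSeq, ih fun k hk => h k (by omega), h n (by omega)]

theorem prod_map_range_apply {α : Type*} (f : ℕ → Equiv.Perm α) (m : ℕ) (p : α) :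
    ((List.range m).map f).prod p = iterSeq (fun n => f (m - 1 - n)) p m := by
  induction m generalizing f with
  | zero => rfl
  | succ m ih =>
    rw [List.range_succ_eq_map, List.map_cons, List.prod_cons, List.map_map, Equiv.Perm.mul_apply,
      ih, iterSeq]
    congr 1
    · simp
    · apply iterSeq_congr
      intro k hk
      simp only [Function.comp_apply]
      congr 1
      omega

namespace CoxeterSystem

variable {B W G : Type*} [Group W] [Group G] {M : CoxeterMatrix B} (cs : CoxeterSystem M W)
  (X : Set B)

section Action

open scoped Classical in
/-- One step of the coset walk: if `s_i c = c x` with `x ∈ X` then the value `η x` is recorded and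
`c` stays unchanged; otherwise `c` moves to `s_i c`. -/
noncomputable def cosetStep (η : B → G) (i : B) (p : G × {w : W // cs.IsCosetMinimal X w}) :
    G × {w : W // cs.IsCosetMinimal X w} :=
  if h : ∃ x ∈ X, cs.simple i * p.2.1 = p.2.1 * cs.simple x then (η h.choose * p.1, p.2)
  else (p.1, ⟨cs.simple i * p.2.1, p.2.2.simple_mul cs h⟩)

variable {X}

theorem cosetStep_of_eq (η : B → G) {i x : B} (p : G × {w : W // cs.IsCosetMinimal X w})
    (hx : x ∈ X) (h : cs.simple i * p.2.1 = p.2.1 * cs.simple x) :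
    cs.cosetStep X η i p = (η x * p.1, p.2) := by
  have hex : ∃ x ∈ X, cs.simple i * p.2.1 = p.2.1 * cs.simple x := ⟨x, hx, h⟩
  have hc : hex.choose = x :=
    cs.simple_injective (mul_left_cancel (hex.choose_spec.2.symm.trans h))
  rw [cosetStep, dif_pos hex, hc]

theorem cosetStep_of_not (η : B → G) {i : B} (p : G × {w : W // cs.IsCosetMinimal X w})
    (h : ¬ ∃ x ∈ X, cs.simple i * p.2.1 = p.2.1 * cs.simple x) :
    cs.cosetStep X η i p = (p.1, ⟨cs.simple i * p.2.1, p.2.2.simple_mul cs h⟩) := by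
  rw [cosetStep, dif_neg h]

theorem cosetStep_inv_cosetStep (η : B → G) (i : B)
    (p : G × {w : W // cs.IsCosetMinimal X w}) :
    cs.cosetStep X η⁻¹ i (cs.cosetStep X η i p) = p := by
  by_cases h : ∃ x ∈ X, cs.simple i * p.2.1 = p.2.1 * cs.simple x
  · obtain ⟨x, hx, hc⟩ := h
    rw [cs.cosetStep_of_eq η p hx hc, cs.cosetStep_of_eq η⁻¹ (η x * p.1, p.2) hx hc]
    simp
  · rw [cs.cosetStep_of_not η p h, cs.cosetStep_of_not]
    · simp
    · rintro ⟨x, hx, hc⟩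
      apply h
      refine ⟨x, hx, ?_⟩
      simpa [mul_assoc] using congrArg (cs.simple i * ·) hc

variable (X)

/-- The permutation given by one step of the coset walk. -/
noncomputable def cosetPerm (η : B → G) (i : B) :
    Equiv.Perm (G × {w : W // cs.IsCosetMinimal X w}) where
  toFun := cs.cosetStep X η i
  invFun := cs.cosetStep X η⁻¹ i
  left_inv := cs.cosetStep_inv_cosetStep η i
  right_inv p := by simpa using cs.cosetStep_inv_cosetStep η⁻¹ i p

variable {X}

theorem cosetPerm_apply (η : B → G) (i : B) (p : G × {w : W // cs.IsCosetMinimal X w}) :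
    cs.cosetPerm X η i p = cs.cosetStep X η i p := rfl

end Action

section Braid

variable {X}

theorem prod_map_cosetPerm_of_eq (θ : ℕ → B → G) {i j x y : B}
    (p : G × {w : W // cs.IsCosetMinimal X w}) (hx : x ∈ X) (hy : y ∈ X)
    (hix : cs.simple i * p.2.1 = p.2.1 * cs.simple x)
    (hjy : cs.simple j * p.2.1 = p.2.1 * cs.simple y) (l : List ℕ) :
    (l.map fun n => cs.cosetPerm X (θ n) (if n % 2 = 0 then i else j)).prod p =
      ((l.map fun n => θ n (if n % 2 = 0 then x else y)).prod * p.1, p.2) := by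
  induction l with
  | nil => simp
  | cons n l ih =>
    rw [List.map_cons, List.prod_cons, Equiv.Perm.mul_apply, ih, List.map_cons, List.prod_cons,
      cosetPerm_apply]
    split_ifs with hn
    · rw [mul_assoc]
      exact cs.cosetStep_of_eq _ (_, p.2) hx hix
    · rw [mul_assoc]
      exact cs.cosetStep_of_eq _ (_, p.2) hy hjy

/-- The alternating product `⋯ s_i s_j` with `n` factors, ending in `s_j`. -/
def altElt (i j : B) : ℕ → W
  | 0 => 1
  | n + 1 => cs.simple (if n % 2 = 0 then j else i) * altElt i j n

theorem altElt_two_mul (i j : B) (k : ℕ) :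
    cs.altElt i j (2 * k) = (cs.simple i * cs.simple j) ^ k := by
  induction k with
  | zero => simp [altElt]
  | succ k ih =>
    rw [show 2 * (k + 1) = 2 * k + 1 + 1 by ring, altElt, altElt, ih, if_neg (by omega),
      if_pos (by omega), pow_succ', mul_assoc]

theorem altElt_two_mul_add_one (i j : B) (k : ℕ) :
    cs.altElt i j (2 * k + 1) = cs.simple j * (cs.simple i * cs.simple j) ^ k := by
  rw [altElt, altElt_two_mul, if_pos (by omega)]

theorem altElt_conj (i j : B) (n : ℕ) :
    (cs.altElt i j n)⁻¹ * cs.simple (if n % 2 = 0 then j else i) * cs.altElt i j n =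
      cs.simple j * (cs.simple i * cs.simple j) ^ n := by
  obtain ⟨k, rfl | rfl⟩ := Nat.even_or_odd' n
  · rw [altElt_two_mul, if_pos (by omega), ← simple_mul_pow, two_mul, pow_add, mul_assoc]
  · rw [altElt_two_mul_add_one, if_neg (by omega), mul_inv_rev, inv_simple, ← simple_mul_pow,
      show 2 * k + 1 = k + (k + 1) by ring, pow_add, pow_succ']
    simp [mul_assoc]

theorem simple_mul_pow_mem_dihedral (i j : B) (n : ℕ) :
    cs.simple j * (cs.simple i * cs.simple j) ^ n ∈ cs.dihedral i j :=
  mul_mem (cs.simple_right_mem_dihedral i j) (pow_mem (mul_mem (cs.simple_left_mem_dihedral i j)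
    (cs.simple_right_mem_dihedral i j)) n)

theorem pow_swap {i j : B} {n l : ℕ} (h : n + l = M i j) :
    (cs.simple j * cs.simple i) ^ l = (cs.simple i * cs.simple j) ^ n := by
  have h1 : (cs.simple i * cs.simple j) ^ n * (cs.simple i * cs.simple j) ^ l = 1 := by
    rw [← pow_add, h, simple_mul_simple_pow]
  rw [eq_inv_of_mul_eq_one_left h1, ← inv_pow, mul_inv_rev, inv_simple, inv_simple]

theorem simple_mul_pow_swap {i j : B} {n l : ℕ} (h : n + l + 1 = M i j) :
    cs.simple i * (cs.simple j * cs.simple i) ^ l =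
      cs.simple j * (cs.simple i * cs.simple j) ^ n := by
  rw [cs.pow_swap (n := n + 1) (by omega), pow_succ']
  simp [mul_assoc]

theorem altElt_swap (i j : B) : cs.altElt i j (M i j) = cs.altElt j i (M i j) := by
  obtain ⟨k, hk⟩ := Nat.even_or_odd' (M i j)
  rcases hk with hk | hk
  · rw [hk, altElt_two_mul, altElt_two_mul, cs.pow_swap (i := i) (j := j) (n := k) (by omega)]
  · rw [hk, altElt_two_mul_add_one, altElt_two_mul_add_one,
      cs.simple_mul_pow_swap (i := i) (j := j) (n := k) (by omega)]

theorem simple_mul_altElt_mul_iff (i j : B) (n : ℕ) (c d : W) :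
    cs.simple (if n % 2 = 0 then j else i) * (cs.altElt i j n * c) = cs.altElt i j n * c * d ↔
      cs.simple j * (cs.simple i * cs.simple j) ^ n = c * d * c⁻¹ := by
  rw [← altElt_conj, eq_mul_inv_iff_mul_eq]
  constructor
  · intro h
    rw [mul_assoc, mul_assoc, h]
    group
  · intro h
    have := congrArg (cs.altElt i j n * ·) h
    simpa [mul_assoc] using this

/-- The coset walk along an alternating word. -/
noncomputable def altWalk (θ : ℕ → B → G) (i j : B) (p : G × {w : W // cs.IsCosetMinimal X w}) :
    ℕ → G × {w : W // cs.IsCosetMinimal X w} :=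
  iterSeq (fun n => cs.cosetPerm X (θ n) (if n % 2 = 0 then j else i)) p

theorem altWalk_succ (θ : ℕ → B → G) (i j : B) (p : G × {w : W // cs.IsCosetMinimal X w}) (n : ℕ) :
    cs.altWalk θ i j p (n + 1) =
      cs.cosetStep X (θ n) (if n % 2 = 0 then j else i) (cs.altWalk θ i j p n) := rfl

theorem altWalk_of_forall_ne (θ : ℕ → B → G) (i j : B)
    (p : G × {w : W // cs.IsCosetMinimal X w}) (n : ℕ)
    (h : ∀ k < n, ∀ x ∈ X, cs.simple j * (cs.simple i * cs.simple j) ^ k ≠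
      p.2.1 * cs.simple x * p.2.1⁻¹) :
    (cs.altWalk θ i j p n).1 = p.1 ∧ (cs.altWalk θ i j p n).2.1 = cs.altElt i j n * p.2.1 := by
  induction n with
  | zero => simp [altWalk, iterSeq, altElt]
  | succ n ih =>
    obtain ⟨h1, h2⟩ := ih fun k hk => h k (by omega)
    rw [altWalk_succ, cs.cosetStep_of_not]
    · simp only [h1, h2, altElt, mul_assoc, and_self]
    · rintro ⟨x, hx, hc⟩
      rw [h2, simple_mul_altElt_mul_iff] at hc
      exact h n (by omega) x hx hc

theorem altWalk_of_eq (θ : ℕ → B → G) {i j x : B}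
    (p : G × {w : W // cs.IsCosetMinimal X w}) {k : ℕ} (hk : k < M i j) (hx : x ∈ X)
    (hkx : cs.simple j * (cs.simple i * cs.simple j) ^ k = p.2.1 * cs.simple x * p.2.1⁻¹)
    (huniq : ∀ y ∈ X, p.2.1 * cs.simple y * p.2.1⁻¹ ∈ cs.dihedral i j → y = x)
    (n : ℕ) (hkn : k < n) (hn : n ≤ M i j) :
    (cs.altWalk θ i j p n).1 = θ k x * p.1 ∧
      (cs.altWalk θ i j p n).2.1 = cs.altElt i j n * (p.2.1 * cs.simple x) := by
  have hne : ∀ l < M i j, l ≠ k → ∀ y ∈ X, cs.simple j * (cs.simple i * cs.simple j) ^ l ≠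
      p.2.1 * cs.simple y * p.2.1⁻¹ := by
    intro l hl hlk y hy h
    have hyx := huniq y hy (h ▸ cs.simple_mul_pow_mem_dihedral i j l)
    subst hyx
    exact hlk (cs.pow_inj_of_lt hl hk (mul_left_cancel (h.trans hkx.symm)))
  induction n with
  | zero => omega
  | succ n ih =>
    rcases Nat.lt_or_ge k n with hlt | hge
    · obtain ⟨h1, h2⟩ := ih hlt (by omega)
      rw [altWalk_succ, cs.cosetStep_of_not]
      · simp only [h1, h2, altElt, mul_assoc, and_self]
      · rintro ⟨y, hy, hc⟩
        rw [h2, simple_mul_altElt_mul_iff] at hc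
        have hy' : p.2.1 * cs.simple y * p.2.1⁻¹ ∈ cs.dihedral i j := by
          have hD := cs.simple_mul_pow_mem_dihedral i j k
          have := mul_mem (mul_mem hD (cs.simple_mul_pow_mem_dihedral i j n)) hD
          rw [hc, hkx] at this
          simpa [mul_assoc] using this
        have hyx := huniq y hy hy'
        subst hyx
        refine hne n (by omega) (by omega) y hy ?_
        rw [hc]
        simp [mul_assoc]
    · have hkn' : k = n := by omega
      subst hkn'
      obtain ⟨h1, h2⟩ := cs.altWalk_of_forall_ne θ i j p k
        fun l hl => hne l (by omega) (by omega)
      rw [altWalk_succ, cs.cosetStep_of_eq _ _ hx]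
      · rw [h1, h2]
        refine ⟨rfl, ?_⟩
        have h3 := (cs.simple_mul_altElt_mul_iff i j k p.2.1 (cs.simple x)).2 hkx
        rw [altElt, mul_assoc, ← mul_assoc (cs.altElt i j k), ← h3]
        simp
      · rw [h2, simple_mul_altElt_mul_iff]
        exact hkx

theorem dihedral_comm (i j : B) : cs.dihedral i j = cs.dihedral j i := by
  rw [dihedral, dihedral, Set.pair_comm]

theorem altWalk_swap (θ : ℕ → B → G) {i j : B} (p : G × {w : W // cs.IsCosetMinimal X w})
    (huniq : ∀ x ∈ X, ∀ y ∈ X, p.2.1 * cs.simple x * p.2.1⁻¹ ∈ cs.dihedral i j →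
      p.2.1 * cs.simple y * p.2.1⁻¹ ∈ cs.dihedral i j → y = x) :
    cs.altWalk θ i j p (M i j) = cs.altWalk (fun n => θ (M i j - 1 - n)) j i p (M i j) := by
  by_cases h : ∃ k < M i j, ∃ x ∈ X,
      cs.simple j * (cs.simple i * cs.simple j) ^ k = p.2.1 * cs.simple x * p.2.1⁻¹
  · obtain ⟨k, hk, x, hx, hkx⟩ := h
    have hxD : p.2.1 * cs.simple x * p.2.1⁻¹ ∈ cs.dihedral i j :=
      hkx ▸ cs.simple_mul_pow_mem_dihedral i j k
    obtain ⟨h1, h2⟩ := cs.altWalk_of_eq θ p hk hx hkx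
      (fun y hy hyD => huniq x hx y hy hxD hyD) (M i j) hk le_rfl
    have hsym := M.symmetric j i
    obtain ⟨h3, h4⟩ := cs.altWalk_of_eq (i := j) (j := i) (fun n => θ (M i j - 1 - n)) p
      (k := M i j - 1 - k) (by omega) hx
      ((cs.simple_mul_pow_swap (n := k) (by omega)).trans hkx)
      (fun y hy hyD => huniq x hx y hy hxD (cs.dihedral_comm i j ▸ hyD)) (M i j) (by omega)
      (by omega)
    refine Prod.ext ?_ (Subtype.ext ?_)
    · rw [h1, h3]
      congr 2
      omega
    · rw [h2, h4, altElt_swap]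
  · push Not at h
    obtain ⟨h1, h2⟩ := cs.altWalk_of_forall_ne θ i j p (M i j) h
    obtain ⟨h3, h4⟩ := cs.altWalk_of_forall_ne (fun n => θ (M i j - 1 - n)) j i p (M i j) (by
      intro k hk x hx
      rw [cs.simple_mul_pow_swap (n := M i j - 1 - k) (by omega)]
      exact h _ (by omega) x hx)
    exact Prod.ext (h1.trans h3.symm) (Subtype.ext (by rw [h2, h4, altElt_swap]))

theorem eq_of_simple_mul_eq {i j x y : B} {c : W} (hx : cs.simple i * c = c * cs.simple x)
    (hy : cs.simple j * c = c * cs.simple y) : M x y = M i j := by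
  have h : SemiconjBy c (cs.simple x * cs.simple y) (cs.simple i * cs.simple j) := by
    rw [SemiconjBy, ← mul_assoc, ← hx, mul_assoc, ← hy, mul_assoc]
  rw [← cs.orderOf_simple_mul_simple, ← cs.orderOf_simple_mul_simple]
  exact h.orderOf_eq

/-- Any relation of braid shape that holds in `G` for all pairs of letters of order `M i j` is
respected by the coset walk. -/
theorem prod_map_cosetPerm_swap (θ : ℕ → B → G) {i j : B} (hm : M i j ≠ 0)
    (hrel : ∀ x y : B, x ≠ y → M x y = M i j →
      ((List.range (M i j)).map fun n => θ n (if n % 2 = 0 then x else y)).prod =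
      ((List.range (M i j)).map fun n => θ (M i j - 1 - n) (if n % 2 = 0 then y else x)).prod) :
    ((List.range (M i j)).map fun n => cs.cosetPerm X (θ n) (if n % 2 = 0 then i else j)).prod =
    ((List.range (M i j)).map fun n =>
      cs.cosetPerm X (θ (M i j - 1 - n)) (if n % 2 = 0 then j else i)).prod := by
  ext1 p
  by_cases h : ∃ x ∈ X, ∃ y ∈ X, p.2.1 * cs.simple x * p.2.1⁻¹ ∈ cs.dihedral i j ∧
      p.2.1 * cs.simple y * p.2.1⁻¹ ∈ cs.dihedral i j ∧ x ≠ y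
  · have key : ∀ x ∈ X, ∀ y ∈ X, x ≠ y → cs.simple i * p.2.1 = p.2.1 * cs.simple x →
        cs.simple j * p.2.1 = p.2.1 * cs.simple y →
        ((List.range (M i j)).map fun n =>
          cs.cosetPerm X (θ n) (if n % 2 = 0 then i else j)).prod p =
        ((List.range (M i j)).map fun n =>
          cs.cosetPerm X (θ (M i j - 1 - n)) (if n % 2 = 0 then j else i)).prod p := by
      intro x hx y hy hxy h1 h2
      rw [cs.prod_map_cosetPerm_of_eq θ p hx hy h1 h2,
        cs.prod_map_cosetPerm_of_eq (fun n => θ (M i j - 1 - n)) p hy hx h2 h1,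
        hrel x y hxy (cs.eq_of_simple_mul_eq h1 h2)]
    obtain ⟨x, hx, y, hy, hxD, hyD, hxy⟩ := h
    rcases IsCosetMinimal.simple_mul_eq cs p.2.2 hm hx hy hxy hxD hyD with ⟨h1, h2⟩ | ⟨h1, h2⟩
    · exact key x hx y hy hxy h1 h2
    · exact key y hy x hx hxy.symm h1 h2
  · have huniq : ∀ x ∈ X, ∀ y ∈ X, p.2.1 * cs.simple x * p.2.1⁻¹ ∈ cs.dihedral i j →
        p.2.1 * cs.simple y * p.2.1⁻¹ ∈ cs.dihedral i j → y = x := by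
      intro x hx y hy hxD hyD
      by_contra hne
      exact h ⟨x, hx, y, hy, hxD, hyD, fun he => hne he.symm⟩
    rw [prod_map_range_apply, prod_map_range_apply]
    rcases Nat.even_or_odd (M i j) with he | ho
    · refine Eq.trans ?_ ((cs.altWalk_swap (fun n => θ (M i j - 1 - n)) p huniq).trans ?_)
      · apply iterSeq_congr
        intro k hk
        rw [Nat.even_iff] at he
        congr 1
        split_ifs <;> first | rfl | omega
      · apply iterSeq_congr
        intro k hk
        rw [Nat.even_iff] at he
        congr 1
        split_ifs <;> first | rfl | omega
    · have hs := M.symmetric j i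
      have := cs.altWalk_swap (i := j) (j := i) (fun n => θ (M i j - 1 - n)) p (by
        rw [dihedral_comm]; exact huniq)
      rw [hs] at this
      refine Eq.trans ?_ (this.trans ?_)
      · apply iterSeq_congr
        intro k hk
        rw [Nat.odd_iff] at ho
        congr 1
        split_ifs <;> first | rfl | omega
      · apply iterSeq_congr
        intro k hk
        rw [Nat.odd_iff] at ho
        congr 1
        split_ifs <;> first | rfl | omega

end Braid

end CoxeterSystem

section AltProd

variable {G H S : Type*} [Group G] [Group H]

theorem map_altProd (φ : G →* H) (a b : G) (m : ℕ) :
    φ (altProd a b m) = altProd (φ a) (φ b) m := by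
  rw [altProd, altProd, map_list_prod, List.map_map]
  congr 2
  ext i
  simp only [Function.comp_apply]
  split_ifs <;> rfl

theorem altProd_succ (a b : G) (m : ℕ) : altProd a b (m + 1) = a * altProd b a m := by
  rw [altProd, altProd, List.range_succ_eq_map, List.map_cons, List.prod_cons, List.map_map]
  congr 3
  ext i
  simp only [Function.comp_apply]
  split_ifs <;> first | rfl | omega

theorem mul_pow_eq_altProd {a b : G} (ha : a * a = 1) (hb : b * b = 1) (m : ℕ) :
    (a * b) ^ m = altProd a b m * (altProd b a m)⁻¹ := by
  induction m generalizing a b with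
  | zero => simp [altProd]
  | succ m ih =>
    rw [altProd_succ, altProd_succ, mul_inv_rev, mul_assoc, ← mul_assoc (altProd b a m), ← ih hb ha,
      inv_eq_of_mul_eq_one_left hb, ← mul_assoc a, ← mul_pow_mul, pow_succ, mul_assoc]

/-- The sequence `f, g, g, g, …`. -/
def headTail {α : Type*} (f g : α) : ℕ → α
  | 0 => f
  | _ + 1 => g

theorem headTail_self {α : Type*} (f : α) (n : ℕ) : headTail f f n = f := by
  cases n <;> rfl

theorem mul_altProd_eq (f g : S → G) (s t : S) {m : ℕ} (hm : m ≠ 0) :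
    f s * altProd (g t) (g s) (m - 1) =
      ((List.range m).map fun n => headTail f g n (if n % 2 = 0 then s else t)).prod := by
  obtain ⟨k, rfl⟩ := Nat.exists_eq_succ_of_ne_zero hm
  rw [altProd, Nat.succ_eq_add_one, List.range_succ_eq_map, List.map_cons, List.prod_cons,
    List.map_map]
  congr 3
  ext i
  simp only [Function.comp_apply, headTail]
  split_ifs <;> first | rfl | omega

theorem altProd_mul_eq (f g : S → G) (s t : S) {m : ℕ} (hm : m ≠ 0) :
    altProd (g t) (g s) (m - 1) * f (if Even m then s else t) =
      ((List.range m).map fun n => headTail f g (m - 1 - n) (if n % 2 = 0 then t else s)).prod := by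
  obtain ⟨k, rfl⟩ := Nat.exists_eq_succ_of_ne_zero hm
  rw [altProd, Nat.succ_eq_add_one, Nat.add_sub_cancel, List.range_succ, List.map_append,
    List.prod_append, List.map_singleton, List.prod_singleton, Nat.sub_self]
  congr 2
  · apply List.map_congr_left
    intro i hi
    rw [List.mem_range] at hi
    obtain ⟨l, hl⟩ : ∃ l, k - i = l + 1 := ⟨k - i - 1, by omega⟩
    rw [hl, headTail]
    split_ifs <;> rfl
  · simp only [Nat.even_iff]
    split_ifs <;> first | rfl | omega

theorem altProd_eq_prod (f : S → G) (s t : S) (m : ℕ) :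
    altProd (f s) (f t) m =
      ((List.range m).map fun n => f (if n % 2 = 0 then s else t)).prod := by
  rw [altProd]
  congr 2
  ext i
  split_ifs <;> rfl

end AltProd

namespace VirtualArtinGroup

section Presentation

variable {S K : Type*} [Group K] (M : CoxeterMatrix S)

/-- The homomorphism out of `VA[Γ]` determined by images of the generators satisfying the defining
relations. -/
def lift {f g : S → K}
    (hf : ∀ s t, s ≠ t → M s t ≠ 0 → altProd (f s) (f t) (M s t) = altProd (f t) (f s) (M s t))
    (hg : ∀ s, g s * g s = 1)
    (hgg : ∀ s t, s ≠ t → M s t ≠ 0 → altProd (g s) (g t) (M s t) = altProd (g t) (g s) (M s t))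
    (hfg : ∀ s t, s ≠ t → M s t ≠ 0 → f s * altProd (g t) (g s) (M s t - 1) =
      altProd (g t) (g s) (M s t - 1) * f (if Even (M s t) then s else t)) :
    VirtualArtinGroup M →* K :=
  PresentedGroup.toGroup (rels := vaRels M) (f := Sum.elim f g) <| by
    rintro r (((⟨s, t, hst, hm, rfl⟩ | ⟨s, rfl⟩) | ⟨s, t, hst, hm, rfl⟩) | ⟨s, t, hst, hm, rfl⟩)
    · simpa [map_altProd, mul_inv_eq_one] using hf s t hst hm
    · simpa using hg s
    · simpa [map_altProd, mul_inv_eq_one] using hgg s t hst hm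
    · rw [map_mul, map_inv, mul_inv_eq_one]
      simpa [map_altProd] using hfg s t hst hm

section Lift

variable {f g : S → K}
    (hf : ∀ s t, s ≠ t → M s t ≠ 0 → altProd (f s) (f t) (M s t) = altProd (f t) (f s) (M s t))
    (hg : ∀ s, g s * g s = 1)
    (hgg : ∀ s t, s ≠ t → M s t ≠ 0 → altProd (g s) (g t) (M s t) = altProd (g t) (g s) (M s t))
    (hfg : ∀ s t, s ≠ t → M s t ≠ 0 → f s * altProd (g t) (g s) (M s t - 1) =
      altProd (g t) (g s) (M s t - 1) * f (if Even (M s t) then s else t))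

theorem lift_sigma (s : S) : lift M hf hg hgg hfg (sigma M s) = f s :=
  PresentedGroup.toGroup.of _

theorem lift_tau (s : S) : lift M hf hg hgg hfg (tau M s) = g s :=
  PresentedGroup.toGroup.of _

end Lift

/-- The quotient map from the free group. -/
def ofFree : FreeGroup (S ⊕ S) →* VirtualArtinGroup M := PresentedGroup.mk (vaRels M)

theorem ofFree_inl (s : S) : ofFree M (FreeGroup.of (Sum.inl s)) = sigma M s := rfl

theorem ofFree_inr (s : S) : ofFree M (FreeGroup.of (Sum.inr s)) = tau M s := rfl

theorem ofFree_eq_one {r : FreeGroup (S ⊕ S)} (hr : r ∈ vaRels M) : ofFree M r = 1 :=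
  PresentedGroup.one_of_mem hr

theorem sigma_braid {s t : S} (hst : s ≠ t) (hm : M s t ≠ 0) :
    altProd (sigma M s) (sigma M t) (M s t) = altProd (sigma M t) (sigma M s) (M s t) := by
  have h := ofFree_eq_one M (Or.inl (Or.inl (Or.inl ⟨s, t, hst, hm, rfl⟩)))
  rwa [map_mul, map_inv, mul_inv_eq_one, map_altProd, map_altProd, ofFree_inl, ofFree_inl] at h

theorem tau_mul_self (s : S) : tau M s * tau M s = 1 := by
  have h := ofFree_eq_one M (Or.inl (Or.inl (Or.inr ⟨s, rfl⟩)))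
  rwa [map_mul, ofFree_inr] at h

theorem tau_braid {s t : S} (hst : s ≠ t) (hm : M s t ≠ 0) :
    altProd (tau M s) (tau M t) (M s t) = altProd (tau M t) (tau M s) (M s t) := by
  have h := ofFree_eq_one M (Or.inl (Or.inr ⟨s, t, hst, hm, rfl⟩))
  rwa [map_mul, map_inv, mul_inv_eq_one, map_altProd, map_altProd, ofFree_inr, ofFree_inr] at h

theorem sigma_mul_altProd {s t : S} (hst : s ≠ t) (hm : M s t ≠ 0) :
    sigma M s * altProd (tau M t) (tau M s) (M s t - 1) =
      altProd (tau M t) (tau M s) (M s t - 1) * sigma M (if Even (M s t) then s else t) := by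
  have h := ofFree_eq_one M (Or.inr ⟨s, t, hst, hm, rfl⟩)
  rwa [map_mul, map_inv, mul_inv_eq_one, map_mul, map_mul, map_altProd, ofFree_inl, ofFree_inl,
    ofFree_inr, ofFree_inr] at h

theorem tau_isLiftable : M.IsLiftable (tau M) := by
  intro i j
  rcases eq_or_ne i j with rfl | hij
  · simp [tau_mul_self]
  rcases eq_or_ne (M i j) 0 with hm | hm
  · rw [hm, pow_zero]
  · rw [mul_pow_eq_altProd (tau_mul_self M i) (tau_mul_self M j), tau_braid M hij hm,
      mul_inv_cancel]

/-- The homomorphism from the Coxeter group sending `s` to `τ_s`. -/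
def ofCoxeter : M.Group →* VirtualArtinGroup M :=
  M.toCoxeterSystem.lift ⟨tau M, tau_isLiftable M⟩

theorem ofCoxeter_simple (s : S) : ofCoxeter M (M.toCoxeterSystem.simple s) = tau M s :=
  M.toCoxeterSystem.lift_apply_simple (tau_isLiftable M) s

theorem simple_braid (s t : S) :
    altProd (M.toCoxeterSystem.simple s) (M.toCoxeterSystem.simple t) (M s t) =
      altProd (M.toCoxeterSystem.simple t) (M.toCoxeterSystem.simple s) (M s t) := by
  rw [← mul_inv_eq_one, ← mul_pow_eq_altProd (CoxeterSystem.simple_mul_simple_self _ _)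
    (CoxeterSystem.simple_mul_simple_self _ _), CoxeterSystem.simple_mul_simple_pow]

/-- The homomorphism to the Coxeter group sending both `σ_s` and `τ_s` to `s`. -/
def toCoxeter : VirtualArtinGroup M →* M.Group :=
  lift M (f := M.toCoxeterSystem.simple) (g := M.toCoxeterSystem.simple)
    (fun s t _ _ => simple_braid M s t) M.toCoxeterSystem.simple_mul_simple_self
    (fun s t _ _ => simple_braid M s t)
    (fun s t _ hm => by
      rw [mul_altProd_eq _ _ _ _ hm, altProd_mul_eq _ _ _ _ hm]
      simp only [headTail_self]
      rw [← altProd_eq_prod, ← altProd_eq_prod, simple_braid])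

theorem toCoxeter_ofCoxeter (w : M.Group) : toCoxeter M (ofCoxeter M w) = w := by
  have h : (toCoxeter M).comp (ofCoxeter M) = MonoidHom.id _ := by
    apply M.toCoxeterSystem.ext_simple
    intro s
    rw [MonoidHom.comp_apply, ofCoxeter_simple]
    exact lift_tau M _ _ _ _ s
  exact DFunLike.congr_fun h w

theorem ofCoxeter_injective : Function.Injective (ofCoxeter M) :=
  Function.LeftInverse.injective (toCoxeter_ofCoxeter M)

end Presentation

section CosetAction

variable {S : Type*} (M : CoxeterMatrix S) (X : Set S)

/-- The minimal representatives of the left cosets of a standard parabolic subgroup of the Coxeter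
group. -/
abbrev MinimalRep : Type _ := {w : M.Group // M.toCoxeterSystem.IsCosetMinimal X w}

theorem cosetPerm_braid (η : S → VirtualArtinGroup M)
    (h : ∀ s t, s ≠ t → M s t ≠ 0 → altProd (η s) (η t) (M s t) = altProd (η t) (η s) (M s t))
    {s t : S} (hm : M s t ≠ 0) :
    altProd (M.toCoxeterSystem.cosetPerm X η s) (M.toCoxeterSystem.cosetPerm X η t) (M s t) =
      altProd (M.toCoxeterSystem.cosetPerm X η t) (M.toCoxeterSystem.cosetPerm X η s) (M s t) := by
  rw [altProd_eq_prod (M.toCoxeterSystem.cosetPerm X η),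
    altProd_eq_prod (M.toCoxeterSystem.cosetPerm X η)]
  refine M.toCoxeterSystem.prod_map_cosetPerm_swap (X := X) (fun _ => η) hm fun x y hxy he => ?_
  rw [← altProd_eq_prod, ← altProd_eq_prod, ← he]
  exact h x y hxy (he ▸ hm)

/-- The action of `VA[Γ]` on pairs of an element of `VA[Γ]` and a minimal coset representative. -/
noncomputable def cosetHom :
    VirtualArtinGroup M →* Equiv.Perm (VirtualArtinGroup M × MinimalRep M X) :=
  lift M (f := M.toCoxeterSystem.cosetPerm X (sigma M)) (g := M.toCoxeterSystem.cosetPerm X (tau M))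
    (fun s t _ hm => cosetPerm_braid M X _ (fun _ _ => sigma_braid M) hm)
    (fun s => by
      have h : (tau M)⁻¹ = tau M := funext fun x => inv_eq_of_mul_eq_one_left (tau_mul_self M x)
      ext1 p
      conv_lhs => enter [1, 1]; rw [← h]
      exact M.toCoxeterSystem.cosetStep_inv_cosetStep (tau M) s p)
    (fun s t _ hm => cosetPerm_braid M X _ (fun _ _ => tau_braid M) hm)
    (fun s t _ hm => by
      have hc : ∀ n, headTail (M.toCoxeterSystem.cosetPerm X (sigma M))
          (M.toCoxeterSystem.cosetPerm X (tau M)) n =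
          M.toCoxeterSystem.cosetPerm X (headTail (sigma M) (tau M) n) := by
        intro n
        cases n <;> rfl
      rw [mul_altProd_eq _ _ _ _ hm, altProd_mul_eq _ _ _ _ hm]
      simp only [hc]
      refine M.toCoxeterSystem.prod_map_cosetPerm_swap (X := X) _ hm fun x y hxy he => ?_
      have hm' : M x y ≠ 0 := he ▸ hm
      rw [← he, ← mul_altProd_eq _ _ _ _ hm', ← altProd_mul_eq _ _ _ _ hm']
      exact sigma_mul_altProd M hxy hm')

theorem cosetHom_sigma (s : S) :
    cosetHom M X (sigma M s) = M.toCoxeterSystem.cosetPerm X (sigma M) s :=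
  lift_sigma M _ _ _ _ s

theorem cosetHom_tau (s : S) :
    cosetHom M X (tau M s) = M.toCoxeterSystem.cosetPerm X (tau M) s :=
  lift_tau M _ _ _ _ s

/-- The trivial coset representative. -/
def oneRep : MinimalRep M X := ⟨1, M.toCoxeterSystem.isCosetMinimal_one⟩

theorem cosetHom_of_mem_parabolic {g : VirtualArtinGroup M} (hg : g ∈ parabolic M X)
    (a : VirtualArtinGroup M) : cosetHom M X g (a, oneRep M X) = (g * a, oneRep M X) := by
  induction hg using Subgroup.closure_induction generalizing a with
  | mem g hg =>
    rcases hg with ⟨x, hx, rfl⟩ | ⟨x, hx, rfl⟩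
    · simp only [cosetHom_sigma]
      exact M.toCoxeterSystem.cosetStep_of_eq _ (a, oneRep M X) hx (by simp [oneRep])
    · simp only [cosetHom_tau]
      exact M.toCoxeterSystem.cosetStep_of_eq _ (a, oneRep M X) hx (by simp [oneRep])
  | one => simp
  | mul g h _ _ ihg ihh => rw [map_mul, Equiv.Perm.mul_apply, ihh, ihg, mul_assoc]
  | inv g _ ih =>
    rw [map_inv, Equiv.Perm.inv_eq_iff_eq, ih, mul_inv_cancel_left]

end CosetAction

end VirtualArtinGroup

section Words

variable {A G : Type*} [Group G] (gen : A → G)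

theorem evalWord_nil : evalWord gen [] = 1 := rfl

theorem evalWord_cons (p : A × Bool) (w : List (A × Bool)) :
    evalWord gen (p :: w) = (if p.2 then gen p.1 else (gen p.1)⁻¹) * evalWord gen w := rfl

theorem evalWord_append (v w : List (A × Bool)) :
    evalWord gen (v ++ w) = evalWord gen v * evalWord gen w := by
  simp [evalWord]

/-- The formal inverse of a word. -/
def invWord (w : List (A × Bool)) : List (A × Bool) := (w.map fun p => (p.1, !p.2)).reverse

theorem evalWord_invWord (w : List (A × Bool)) :
    evalWord gen (invWord w) = (evalWord gen w)⁻¹ := by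
  induction w with
  | nil => simp [invWord, evalWord]
  | cons p w ih =>
    have h : invWord (p :: w) = invWord w ++ [(p.1, !p.2)] := by simp [invWord]
    rw [h, evalWord_append, ih, evalWord_cons, evalWord_cons, evalWord_nil, mul_inv_rev]
    obtain ⟨a, b⟩ := p
    cases b <;> simp

theorem evalWord_mem (H : Subgroup G) {w : List (A × Bool)} (h : ∀ p ∈ w, gen p.1 ∈ H) :
    evalWord gen w ∈ H := by
  apply Subgroup.list_prod_mem
  intro g hg
  obtain ⟨p, hp, rfl⟩ := List.mem_map.1 hg
  split_ifs
  · exact h p hp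
  · exact inv_mem (h p hp)

end Words

section Computability

theorem natRec_eq_foldl_take {α β : Type*} (f : α → β → β) (l : List α) (b : β) (n : ℕ) :
    (Nat.rec b (fun k s => (l[k]?).elim s fun a => f a s) n : β) =
      (l.take n).foldl (fun s a => f a s) b := by
  induction n with
  | zero => rfl
  | succ n ih =>
    rw [List.take_add_one, List.foldl_append]
    simp only [ih]
    cases l[n]? <;> rfl

theorem Computable.list_foldr_const {α β : Type*} [Primcodable α] [Primcodable β] {f : α → β → β}
    (hf : Computable₂ f) (b : β) : Computable fun l : List α => l.foldr f b := by
  have h : Computable fun l : List α => (Nat.rec b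
      (fun k s => Option.casesOn (l.reverse[k]?) s fun a => f a s) l.length : β) := by
    refine Computable.nat_rec (f := fun l : List α => l.length)
      (h := fun l p => Option.casesOn (l.reverse[p.1]?) p.2 fun a => f a p.2)
      Computable.list_length (Computable.const b) ?_
    refine Computable.option_casesOn (o := fun q : List α × ℕ × β => q.1.reverse[q.2.1]?)
      (f := fun q => q.2.2) (g := fun q a => f a q.2.2)
      (Computable.list_getElem?.comp (Computable.list_reverse.comp Computable.fst)
        (Computable.fst.comp Computable.snd))
      (Computable.snd.comp Computable.snd) ?_
    exact hf.comp Computable.snd (Computable.snd.comp (Computable.snd.comp Computable.fst))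
  refine h.of_eq fun l => ?_
  have h2 := natRec_eq_foldl_take f l.reverse b l.length
  rw [← List.length_reverse, List.take_length, List.foldl_reverse, List.length_reverse] at h2
  rw [← h2]
  congr 1
  ext k s
  cases l.reverse[k]? <;> rfl

theorem invWord_primrec {A : Type*} [Primcodable A] :
    Primrec (invWord : List (A × Bool) → List (A × Bool)) :=
  Primrec.list_reverse.comp <| Primrec.list_map Primrec.id <|
    (Primrec.pair (Primrec.fst.comp Primrec.snd)
      (Primrec.not.comp (Primrec.snd.comp Primrec.snd))).to₂

end Computability

namespace VirtualArtinGroup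

/-- The underlying vertex of a generator. -/
def vertex {S : Type*} (a : S ⊕ S) : S := Sum.elim id id a

/-- The generator of the same kind as `a` at the vertex `x`. -/
def atVertex {S : Type*} (a : S ⊕ S) (x : S) : S ⊕ S :=
  Sum.map (fun _ => x) (fun _ => x) a

section Algorithm

variable {S : Type*} (D : List ((S ⊕ S) × Bool) → Bool)

/-- The word `τ_s · st · τ_x · st⁻¹`. -/
def conjWord (s x : S) (st : List ((S ⊕ S) × Bool)) : List ((S ⊕ S) × Bool) :=
  (Sum.inr s, true) :: (st ++ (Sum.inr x, true) :: invWord st)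

/-- Find the first `x` in the list for which the test `D` accepts `τ_s · st · τ_x · st⁻¹`. -/
def findVertex (s : S) (st : List ((S ⊕ S) × Bool)) : List S → Option S
  | [] => none
  | x :: l => bif D (conjWord s x st) then some x else findVertex s st l

theorem findVertex_eq_some {s : S} {st : List ((S ⊕ S) × Bool)} {l : List S} {x : S}
    (h : findVertex D s st l = some x) : x ∈ l ∧ D (conjWord s x st) = true := by
  induction l with
  | nil => simp [findVertex] at h
  | cons y l ih =>
    rw [findVertex] at h
    cases hD : D (conjWord s y st) with
    | true =>
      rw [hD, cond_true, Option.some_inj] at h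
      subst h
      exact ⟨List.mem_cons_self, hD⟩
    | false =>
      rw [hD, cond_false] at h
      exact ⟨List.mem_cons_of_mem _ (ih h).1, (ih h).2⟩

theorem findVertex_eq_none {s : S} {st : List ((S ⊕ S) × Bool)} {l : List S}
    (h : findVertex D s st l = none) {x : S} (hx : x ∈ l) : D (conjWord s x st) = false := by
  induction l with
  | nil => simp at hx
  | cons y l ih =>
    rw [findVertex] at h
    cases hD : D (conjWord s y st) with
    | true => rw [hD, cond_true] at h; cases h
    | false =>
      rw [hD, cond_false] at h
      rcases List.mem_cons.1 hx with rfl | hx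
      · exact hD
      · exact ih h hx

/-- Process one letter of the input, given the output so far and a word for the current coset
representative. -/
def walkStep (l : List S) (p : (S ⊕ S) × Bool)
    (q : List ((S ⊕ S) × Bool) × List ((S ⊕ S) × Bool)) :
    List ((S ⊕ S) × Bool) × List ((S ⊕ S) × Bool) :=
  Option.casesOn (findVertex D (vertex p.1) q.2 l)
    (q.1, (Sum.inr (vertex p.1), true) :: q.2)
    (fun x => ((atVertex p.1 x, p.2) :: q.1, q.2))

/-- Process a whole word. -/
def walk (l : List S) (w : List ((S ⊕ S) × Bool)) :
    List ((S ⊕ S) × Bool) × List ((S ⊕ S) × Bool) :=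
  w.foldr (walkStep D l) ([], [])

/-- Rewrite a word as a word in the generators of the parabolic subgroup, if possible. -/
def rewriteWord (l : List S) (w : List ((S ⊕ S) × Bool)) : Option (List ((S ⊕ S) × Bool)) :=
  bif D ((walk D l w).1 ++ invWord w) then some (walk D l w).1 else none

variable [Fintype S] [DecidableEq S]

theorem computable_conjWord (x : S) :
    Computable fun q : S × List ((S ⊕ S) × Bool) => conjWord q.1 x q.2 := by
  have h : Primrec fun s : S => ((Sum.inr s, true) : (S ⊕ S) × Bool) := Primrec.dom_finite _
  refine Primrec.to_comp (Primrec.list_cons.comp (h.comp Primrec.fst) ?_)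
  exact Primrec.list_append.comp Primrec.snd
    (Primrec.list_cons.comp (Primrec.const _) (invWord_primrec.comp Primrec.snd))

variable {D}

theorem computable_findVertex (hD : Computable D) (l : List S) :
    Computable fun q : S × List ((S ⊕ S) × Bool) => findVertex D q.1 q.2 l := by
  induction l with
  | nil => exact Computable.const none
  | cons x l ih =>
    exact Computable.cond (hD.comp (computable_conjWord x)) (Computable.const (some x)) ih

theorem computable_walkStep (hD : Computable D) (l : List S) : Computable₂ (walkStep D l) := by
  have h1 : Primrec fun p : (S ⊕ S) × Bool => vertex p.1 := Primrec.dom_finite _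
  have h2 : Primrec fun p : (S ⊕ S) × Bool =>
      ((Sum.inr (vertex p.1), true) : (S ⊕ S) × Bool) := Primrec.dom_finite _
  have h3 : Primrec fun p : ((S ⊕ S) × Bool) × S =>
      ((atVertex p.1.1 p.2, p.1.2) : (S ⊕ S) × Bool) := Primrec.dom_finite _
  refine Computable.option_casesOn
    (o := fun q : ((S ⊕ S) × Bool) × List ((S ⊕ S) × Bool) × List ((S ⊕ S) × Bool) =>
      findVertex D (vertex q.1.1) q.2.2 l) ?_ ?_ ?_
  · exact (computable_findVertex hD l).comp
      (Computable.pair (h1.to_comp.comp Computable.fst) (Computable.snd.comp Computable.snd))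
  · exact Primrec.to_comp (Primrec.pair (Primrec.fst.comp Primrec.snd)
      (Primrec.list_cons.comp (h2.comp Primrec.fst) (Primrec.snd.comp Primrec.snd)))
  · exact Primrec.to_comp (Primrec.pair
      (Primrec.list_cons.comp
        (h3.comp (Primrec.pair (Primrec.fst.comp Primrec.fst) Primrec.snd))
        (Primrec.fst.comp (Primrec.snd.comp Primrec.fst)))
      (Primrec.snd.comp (Primrec.snd.comp Primrec.fst)))

theorem computable_rewriteWord (hD : Computable D) (l : List S) :
    Computable (rewriteWord D l) := by
  have hw : Computable fun w => (walk D l w).1 :=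
    Computable.fst.comp (Computable.list_foldr_const (computable_walkStep hD l) _)
  exact Computable.cond
    (hD.comp (Computable.list_append.comp hw invWord_primrec.to_comp))
    (Computable.option_some.comp hw) (Computable.const none)

end Algorithm

section Correctness

variable {S : Type*} (M : CoxeterMatrix S) (X : Set S)

/-- The generators of `VA[Γ]`. -/
abbrev gens : S ⊕ S → VirtualArtinGroup M := Sum.elim (sigma M) (tau M)

theorem cosetHom_letter (p : (S ⊕ S) × Bool) (q : VirtualArtinGroup M × MinimalRep M X) :
    cosetHom M X (if p.2 then gens M p.1 else (gens M p.1)⁻¹) q =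
      M.toCoxeterSystem.cosetStep X (fun x => if p.2 then gens M (atVertex p.1 x) else
        (gens M (atVertex p.1 x))⁻¹) (vertex p.1) q := by
  obtain ⟨a | a, _ | _⟩ := p
  · simp only [Bool.false_eq_true, if_false, map_inv]
    exact congrArg (fun e => (e⁻¹ : Equiv.Perm _) q) (cosetHom_sigma M X a)
  · exact congrArg (fun e => (e : Equiv.Perm _) q) (cosetHom_sigma M X a)
  · simp only [Bool.false_eq_true, if_false, map_inv]
    exact congrArg (fun e => (e⁻¹ : Equiv.Perm _) q) (cosetHom_tau M X a)
  · exact congrArg (fun e => (e : Equiv.Perm _) q) (cosetHom_tau M X a)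

variable {D : List ((S ⊕ S) × Bool) → Bool}

theorem test_conjWord (hD : ∀ w, D w = true ↔ evalWord (gens M) w = 1) (s x : S)
    {st : List ((S ⊕ S) × Bool)} {c : M.Group} (hst : evalWord (gens M) st = ofCoxeter M c) :
    D (conjWord s x st) = true ↔
      M.toCoxeterSystem.simple s * c = c * M.toCoxeterSystem.simple x := by
  have h : evalWord (gens M) (conjWord s x st) = ofCoxeter M
      (M.toCoxeterSystem.simple s * (c * (M.toCoxeterSystem.simple x * c⁻¹))) := by
    rw [conjWord, evalWord_cons, evalWord_append, evalWord_cons, evalWord_invWord, hst]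
    simp only [map_mul, map_inv, ofCoxeter_simple, if_true, Sum.elim_inr]
  rw [hD, h, map_eq_one_iff _ (ofCoxeter_injective M), ← mul_assoc, ← mul_assoc, mul_inv_eq_one,
    ← eq_mul_inv_iff_mul_eq, CoxeterSystem.inv_simple]

theorem atVertex_mem (a : S ⊕ S) {x : S} (hx : x ∈ X) :
    atVertex a x ∈ Sum.inl '' X ∪ Sum.inr '' X := by
  cases a with
  | inl a => exact Or.inl ⟨x, hx, rfl⟩
  | inr a => exact Or.inr ⟨x, hx, rfl⟩

theorem gens_mem_parabolic {a : S ⊕ S} (ha : a ∈ Sum.inl '' X ∪ Sum.inr '' X) :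
    gens M a ∈ parabolic M X := by
  apply Subgroup.subset_closure
  rcases ha with ⟨x, hx, rfl⟩ | ⟨x, hx, rfl⟩
  · exact Or.inl ⟨x, hx, rfl⟩
  · exact Or.inr ⟨x, hx, rfl⟩

variable {X}

theorem walk_spec (hD : ∀ w, D w = true ↔ evalWord (gens M) w = 1) {l : List S}
    (hl : ∀ x, x ∈ l ↔ x ∈ X) (w : List ((S ⊕ S) × Bool)) :
    (∀ p ∈ (walk D l w).1, p.1 ∈ Sum.inl '' X ∪ Sum.inr '' X) ∧
    ∃ c : MinimalRep M X, evalWord (gens M) (walk D l w).2 = ofCoxeter M c.1 ∧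
      cosetHom M X (evalWord (gens M) w) (1, oneRep M X) =
        (evalWord (gens M) (walk D l w).1, c) := by
  induction w with
  | nil => exact ⟨by simp [walk], oneRep M X, by simp [walk, evalWord, oneRep],
      by simp [walk, evalWord]⟩
  | cons p w ih =>
    obtain ⟨h1, c, h2, h3⟩ := ih
    have hw : walk D l (p :: w) = walkStep D l p (walk D l w) := rfl
    rw [hw, evalWord_cons, map_mul, Equiv.Perm.mul_apply, h3, cosetHom_letter, walkStep]
    cases hf : findVertex D (vertex p.1) (walk D l w).2 l with
    | some x =>
      obtain ⟨hx, hDx⟩ := findVertex_eq_some D hf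
      have hX := (hl x).1 hx
      refine ⟨?_, c, h2, ?_⟩
      · intro q hq
        rcases List.mem_cons.1 hq with rfl | hq
        · exact atVertex_mem X _ hX
        · exact h1 q hq
      · exact M.toCoxeterSystem.cosetStep_of_eq _ (_, c) hX ((test_conjWord M hD _ _ h2).1 hDx)
    | none =>
      have hno : ¬ ∃ x ∈ X, M.toCoxeterSystem.simple (vertex p.1) * c.1 =
          c.1 * M.toCoxeterSystem.simple x := by
        rintro ⟨x, hx, hc⟩
        have := findVertex_eq_none D hf ((hl x).2 hx)
        rw [(test_conjWord M hD _ _ h2).2 hc] at this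
        cases this
      refine ⟨h1, ⟨M.toCoxeterSystem.simple (vertex p.1) * c.1, c.2.simple_mul _ hno⟩, ?_, ?_⟩
      · rw [evalWord_cons, h2, map_mul, ofCoxeter_simple]
        rfl
      · exact M.toCoxeterSystem.cosetStep_of_not _ (_, c) hno

theorem rewriteWord_spec (hD : ∀ w, D w = true ↔ evalWord (gens M) w = 1) {l : List S}
    (hl : ∀ x, x ∈ l ↔ x ∈ X) (w : List ((S ⊕ S) × Bool)) :
    (evalWord (gens M) w ∈ parabolic M X ↔ (rewriteWord D l w).isSome) ∧
      ∀ μ, rewriteWord D l w = some μ → (∀ p ∈ μ, p.1 ∈ Sum.inl '' X ∪ Sum.inr '' X) ∧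
        evalWord (gens M) μ = evalWord (gens M) w := by
  obtain ⟨h1, c, -, h3⟩ := walk_spec M hD hl w
  have hDw : D ((walk D l w).1 ++ invWord w) = true ↔
      evalWord (gens M) (walk D l w).1 = evalWord (gens M) w := by
    rw [hD, evalWord_append, evalWord_invWord, mul_inv_eq_one]
  rw [rewriteWord]
  cases hb : D ((walk D l w).1 ++ invWord w) with
  | true =>
    have he := hDw.1 hb
    simp only [cond_true, Option.isSome_some, iff_true, Option.some_inj]
    refine ⟨?_, ?_⟩
    · rw [← he]
      exact evalWord_mem _ _ fun p hp => gens_mem_parabolic M X (h1 p hp)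
    · rintro μ rfl
      exact ⟨h1, he⟩
  | false =>
    simp only [cond_false, Option.isSome_none, Bool.false_eq_true, iff_false, reduceCtorEq,
      false_imp_iff, implies_true, and_true]
    intro hmem
    rw [cosetHom_of_mem_parabolic M X hmem, mul_one] at h3
    rw [hDw.2 (congrArg Prod.fst h3).symm] at hb
    cases hb

end Correctness

end VirtualArtinGroup

/-- **Theorem 1.6.** If the word problem in `VA[Γ]` is solvable, then the strong membership
problem for the standard parabolic subgroup `VA_X[Γ]` in `VA[Γ]` is solvable. -/
theorem va_strong_membership_of_word_problem {S : Type*} [Fintype S] [DecidableEq S]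
    (M : CoxeterMatrix S) (X : Set S)
    (h : SolvableWordProblem (Sum.elim (VirtualArtinGroup.sigma M) (VirtualArtinGroup.tau M))) :
    SolvableStrongMembership
      (Sum.elim (VirtualArtinGroup.sigma M) (VirtualArtinGroup.tau M))
      (Sum.inl '' X ∪ Sum.inr '' X)
      (VirtualArtinGroup.parabolic M X) := by
  classical
  obtain ⟨D, hD, hp⟩ := ComputablePred.computable_iff.1 h
  have hl : ∀ x, x ∈ X.toFinset.toList ↔ x ∈ X := fun x => by
    rw [Finset.mem_toList, Set.mem_toFinset]
  exact ⟨VirtualArtinGroup.rewriteWord D X.toFinset.toList,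
    VirtualArtinGroup.computable_rewriteWord hD _,
    VirtualArtinGroup.rewriteWord_spec M (fun w => (iff_of_eq (congrFun hp w)).symm) hl⟩
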